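/- arXiv:2605.21365 — 2 statements merged into one kernel-verified Lean document; each statement's English description precedes it below -/
import Mathlib

section
/- If the σ-algebra 𝒜 on Ω is countably generated, then the metric space (L²_W(ℝ^d), d), where d(ξ,η) = E_ω[W₂²(ξ(ω),η(ω))]^{1/2} and elements equal ℙ-a.s. are identified, is a Polish space: it is complete and separable. -/
open MeasureTheory Filter Topology ProbabilityTheory
open scoped ENNReal NNReal RealInnerProductSpace BigOperators

noncomputable section

/-- Euclidean space `ℝ^d`. -/
abbrev Ed (d : ℕ) : Type := EuclideanSpace ℝ (Fin d)

/-- `γ` is a coupling of `μ` and `ν`: a joint probability measure on `ℝ^d × ℝ^d`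
with marginals `μ` and `ν`. -/
def IsCoupling {d : ℕ} (γ : Measure (Ed d × Ed d)) (μ ν : Measure (Ed d)) : Prop :=
  IsProbabilityMeasure γ ∧ γ.map Prod.fst = μ ∧ γ.map Prod.snd = ν

/-- The set of quadratic transport costs of couplings between `μ` and `ν`. -/
def transportCosts {d : ℕ} (μ ν : Measure (Ed d)) : Set ℝ :=
  {c : ℝ | ∃ γ : Measure (Ed d × Ed d), IsCoupling γ μ ν ∧ c = ∫ p, ‖p.1 - p.2‖ ^ 2 ∂γ}

/-- The 2-Wasserstein distance `W₂(μ,ν)`. -/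
def W2 {d : ℕ} (μ ν : Measure (Ed d)) : ℝ :=
  Real.sqrt (sInf (transportCosts μ ν))

/-- `μ ∈ 𝒫₂(ℝ^d)`: a probability measure with finite second moment. -/
def MemP2 {d : ℕ} (μ : Measure (Ed d)) : Prop :=
  IsProbabilityMeasure μ ∧ Integrable (fun x => ‖x‖ ^ 2) μ

/-- The Borel σ-algebra of the `W₂`-topology on measures: the σ-algebra generated by
`W₂`-balls. -/
def W2MS (d : ℕ) : MeasurableSpace (Measure (Ed d)) :=
  MeasurableSpace.generateFrom {s : Set (Measure (Ed d)) | ∃ μ r, s = {ν | W2 μ ν < r}}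

/-- `ξ ∈ L²_W(ℝ^d)`: a random probability measure with realisations in `𝒫₂(ℝ^d)`,
measurable w.r.t. the Borel σ-algebra of the `W₂` topology, with finite second energy. -/
structure MemL2W {d : ℕ} {Ω : Type*} [MeasurableSpace Ω] (P : Measure Ω)
    (ξ : Ω → Measure (Ed d)) : Prop where
  prob : ∀ ω, IsProbabilityMeasure (ξ ω)
  mom : ∀ ω, Integrable (fun x => ‖x‖ ^ 2) (ξ ω)
  meas : @Measurable Ω (Measure (Ed d)) _ (W2MS d) ξ
  energy : Integrable (fun ω => ∫ x, ‖x‖ ^ 2 ∂(ξ ω)) P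

/-- The `L²` over Wasserstein distance `d(ξ,η) = E_ω[W₂²(ξ(ω),η(ω))]^{1/2}`. -/
def dL2 {d : ℕ} {Ω : Type*} [MeasurableSpace Ω] (P : Measure Ω)
    (ξ η : Ω → Measure (Ed d)) : ℝ :=
  Real.sqrt (∫ ω, (W2 (ξ ω) (η ω)) ^ 2 ∂P)

lemma chain_exists {d : ℕ} (μ : ℕ → Measure (Ed d)) (γ : ℕ → Measure (Ed d × Ed d))
    (h : ∀ n, IsCoupling (γ n) (μ n) (μ (n + 1))) :
    ∃ Q : Measure (ℕ → Ed d), IsProbabilityMeasure Q ∧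
      ∀ n, Q.map (fun x => (x n, x (n + 1))) = γ n := by
  have : ∀ n, IsProbabilityMeasure (γ n) := fun n => (h n).1
  have : IsProbabilityMeasure (μ 0) := by
    rw [← (h 0).2.1]; exact Measure.isProbabilityMeasure_map (by fun_prop)
  let κ : (n : ℕ) → Kernel (Π _ : Finset.Iic n, Ed d) (Ed d) := fun n =>
    ((γ n).condKernel).comap (fun x => x ⟨n, Finset.mem_Iic.2 le_rfl⟩) (by fun_prop)
  have : ∀ n, IsMarkovKernel (κ n) := fun n => by dsimp only [κ]; infer_instance
  let Q : Measure (ℕ → Ed d) := Kernel.trajMeasure (X := fun _ => Ed d) (μ 0) κ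
  have key : ∀ n, Q.map (fun x => (x n, x (n + 1))) =
      (Q.map (fun x => x n)) ⊗ₘ (γ n).condKernel := by
    intro n
    have h1 := Kernel.map_frestrictLe_trajMeasure_compProd_eq_map_trajMeasure
      (X := fun _ => Ed d) (κ := κ) (μ₀ := μ 0) (a := n)
    have h2 : Q.map (fun x => (x n, x (n + 1))) =
        (Q.map (fun x => (Preorder.frestrictLe (π := fun _ => Ed d) n x, x (n + 1)))).map
          (fun p => (p.1 ⟨n, Finset.mem_Iic.2 le_rfl⟩, p.2)) := by
      rw [Measure.map_map (by fun_prop) (by fun_prop)]; rfl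
    have h3 : Q.map (fun x => x n) = (Q.map (Preorder.frestrictLe (π := fun _ => Ed d) n)).map
        (fun p => p ⟨n, Finset.mem_Iic.2 le_rfl⟩) := by
      rw [Measure.map_map (by fun_prop) (by fun_prop)]; rfl
    rw [h2, h3, ← h1]
    ext s hs
    rw [Measure.map_apply (by fun_prop) hs, Measure.compProd_apply (by measurability),
      Measure.compProd_apply hs,
      lintegral_map (f := fun a => (γ n).condKernel a (Prod.mk a ⁻¹' s))
        (Kernel.measurable_kernel_prodMk_left hs) (by fun_prop)]
    rfl
  have hfst : ∀ n, (γ n).fst ⊗ₘ (γ n).condKernel = γ n := fun n => (γ n).disintegrate _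
  have step : ∀ n, Q.map (fun x => x n) = μ n → Q.map (fun x => (x n, x (n + 1))) = γ n := by
    intro n hn
    rw [key, hn, ← (h n).2.1]; exact hfst n
  have marg : ∀ n, Q.map (fun x => x n) = μ n := by
    intro n
    induction n with
    | zero =>
      have : (fun x : ℕ → Ed d => x 0) = (MeasurableEquiv.piUnique (fun _ : Finset.Iic 0 => Ed d)) ∘
        (Preorder.frestrictLe (π := fun _ => Ed d) 0) := rfl
      rw [this, ← Measure.map_map (by fun_prop) (by fun_prop)]
      dsimp only [Q, Kernel.trajMeasure]
      rw [Measure.map_comp _ _ (by fun_prop), Kernel.traj_map_frestrictLe, Kernel.partialTraj_self,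
        Measure.id_comp, Measure.map_map (by fun_prop) (by fun_prop)]
      exact Measure.map_id
    | succ n ih =>
      rw [← (h n).2.2, ← step n ih, Measure.map_map (by fun_prop) (by fun_prop)]; rfl
  exact ⟨Q, inferInstance, fun n => step n (marg n)⟩

lemma sqrt_integral_sq {Ω' F : Type*} [MeasurableSpace Ω'] [NormedAddCommGroup F] {Q : Measure Ω'}
    {f : Ω' → F} (hf : MemLp f 2 Q) : Real.sqrt (∫ x, ‖f x‖ ^ 2 ∂Q) = (eLpNorm f 2 Q).toReal := by
  rw [hf.eLpNorm_eq_integral_rpow_norm (by norm_num) (by norm_num), ENNReal.toReal_ofReal (by positivity),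
    Real.sqrt_eq_rpow]
  simp

lemma costs_bdd {d : ℕ} (μ ν : Measure (Ed d)) : BddBelow (transportCosts μ ν) :=
  ⟨0, by rintro c ⟨γ, -, rfl⟩; positivity⟩

lemma W2_nonneg {d : ℕ} (μ ν : Measure (Ed d)) : 0 ≤ W2 μ ν := Real.sqrt_nonneg _

lemma W2_map_le {d : ℕ} {Ω' : Type*} [MeasurableSpace Ω'] {Q : Measure Ω'} [IsProbabilityMeasure Q]
    {X Y : Ω' → Ed d} (hX : MemLp X 2 Q) (hY : MemLp Y 2 Q) :
    W2 (Q.map X) (Q.map Y) ≤ (eLpNorm (X - Y) 2 Q).toReal := by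
  rw [← sqrt_integral_sq (hX.sub hY), W2]
  apply Real.sqrt_le_sqrt
  apply csInf_le (costs_bdd _ _)
  have hXm := hX.1.aemeasurable
  have hYm := hY.1.aemeasurable
  refine ⟨Q.map (fun ω => (X ω, Y ω)), ⟨Measure.isProbabilityMeasure_map (hXm.prodMk hYm), ?_, ?_⟩, ?_⟩
  · rw [AEMeasurable.map_map_of_aemeasurable (by fun_prop) (hXm.prodMk hYm)]; rfl
  · rw [AEMeasurable.map_map_of_aemeasurable (by fun_prop) (hXm.prodMk hYm)]; rfl
  · rw [integral_map (hXm.prodMk hYm)]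
    · rfl
    · exact Measurable.aestronglyMeasurable (by fun_prop)

lemma MemP2.memLp {d : ℕ} {μ : Measure (Ed d)} (h : MemP2 μ) : MemLp (fun x => x) 2 μ := by
  exact (memLp_two_iff_integrable_sq_norm (by fun_prop)).2 h.2

lemma memLp_of_map {d : ℕ} {Ω' : Type*} [MeasurableSpace Ω'] {Q : Measure Ω'}
    {X : Ω' → Ed d} (hX : AEMeasurable X Q) (h : MemP2 (Q.map X)) : MemLp X 2 Q := by
  have := (memLp_map_measure_iff (by fun_prop) hX).1 h.memLp
  exact this

lemma memP2_map {d : ℕ} {Ω' : Type*} [MeasurableSpace Ω'] {Q : Measure Ω'} [IsProbabilityMeasure Q]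
    {X : Ω' → Ed d} (hX : MemLp X 2 Q) : MemP2 (Q.map X) := by
  refine ⟨Measure.isProbabilityMeasure_map hX.1.aemeasurable, ?_⟩
  rw [integrable_map_measure (by fun_prop) hX.1.aemeasurable]
  exact hX.norm.integrable_sq

lemma exists_coupling_lt {d : ℕ} {μ ν : Measure (Ed d)} (hμ : MemP2 μ) (hν : MemP2 ν) {r : ℝ}
    (hr : W2 μ ν < r) : ∃ γ, IsCoupling γ μ ν ∧
      (eLpNorm ((fun p => p.1 : Ed d × Ed d → Ed d) - (fun p => p.2)) 2 γ).toReal < r := by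
  have := hμ.1
  have := hν.1
  have hne : (transportCosts μ ν).Nonempty :=
    ⟨_, μ.prod ν, ⟨inferInstance, by simp, by simp⟩, rfl⟩
  have h0 : 0 < r := (W2_nonneg _ _).trans_lt hr
  rw [W2, Real.sqrt_lt' h0] at hr
  obtain ⟨c, ⟨γ, hγ, rfl⟩, hc⟩ := exists_lt_of_csInf_lt hne hr
  refine ⟨γ, hγ, ?_⟩
  have h1 : MemLp (fun p => p.1 : Ed d × Ed d → Ed d) 2 γ :=
    memLp_of_map (by fun_prop) (by rw [show γ.map _ = μ from hγ.2.1]; exact hμ)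
  have h2 : MemLp (fun p => p.2 : Ed d × Ed d → Ed d) 2 γ :=
    memLp_of_map (by fun_prop) (by rw [show γ.map _ = ν from hγ.2.2]; exact hν)
  rw [← sqrt_integral_sq (h1.sub h2), Real.sqrt_lt' h0]
  exact hc

/-- a chain of near-optimal couplings -/
lemma chain_rv {d : ℕ} (μ : ℕ → Measure (Ed d)) (hμ : ∀ n, MemP2 (μ n)) (r : ℕ → ℝ)
    (hr : ∀ n, W2 (μ n) (μ (n + 1)) < r n) :
    ∃ Q : Measure (ℕ → Ed d), IsProbabilityMeasure Q ∧ (∀ n, Q.map (fun x => x n) = μ n) ∧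
      (∀ n, MemLp (fun x : ℕ → Ed d => x n) 2 Q) ∧
      ∀ n, (eLpNorm ((fun x : ℕ → Ed d => x n) - (fun x => x (n + 1))) 2 Q).toReal < r n := by
  choose γ hγ hγr using fun n => exists_coupling_lt (hμ n) (hμ (n + 1)) (hr n)
  obtain ⟨Q, hQ, hQm⟩ := chain_exists μ γ hγ
  have hm : ∀ n, Q.map (fun x => x n) = μ n := fun n => by
    rw [← (hγ n).2.1, ← hQm n, Measure.map_map (by fun_prop) (by fun_prop)]; rfl
  refine ⟨Q, hQ, hm, fun n => memLp_of_map (measurable_pi_apply n).aemeasurable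
    (by rw [hm]; exact hμ n), fun n => ?_⟩
  have := hγr n
  rw [← hQm n, eLpNorm_map_measure (by fun_prop) (by fun_prop)] at this
  exact this

lemma W2_self {d : ℕ} {μ : Measure (Ed d)} (hμ : MemP2 μ) : W2 μ μ = 0 := by
  have := hμ.1
  have := W2_map_le hμ.memLp hμ.memLp
  simp only [Measure.map_id'] at this
  simp at this
  exact le_antisymm this (W2_nonneg _ _)

lemma W2_le_symm {d : ℕ} {μ ν : Measure (Ed d)} (hμ : MemP2 μ) (hν : MemP2 ν) :
    W2 μ ν ≤ W2 ν μ := by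
  refine le_of_forall_gt_imp_ge_of_dense fun r hr => ?_
  obtain ⟨γ, hγ, h⟩ := exists_coupling_lt hν hμ hr
  have := hγ.1
  have h1 : MemLp (fun p => p.1 : Ed d × Ed d → Ed d) 2 γ :=
    memLp_of_map (by fun_prop) (by rw [show γ.map _ = ν from hγ.2.1]; exact hν)
  have h2 : MemLp (fun p => p.2 : Ed d × Ed d → Ed d) 2 γ :=
    memLp_of_map (by fun_prop) (by rw [show γ.map _ = μ from hγ.2.2]; exact hμ)
  have h3 := W2_map_le h2 h1
  rw [eLpNorm_sub_comm] at h3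
  rw [show γ.map (fun p => p.1) = ν from hγ.2.1, show γ.map (fun p => p.2) = μ from hγ.2.2] at h3
  linarith

lemma W2_triangle {d : ℕ} {μ ν ρ : Measure (Ed d)} (hμ : MemP2 μ) (hν : MemP2 ν) (hρ : MemP2 ρ) :
    W2 μ ρ ≤ W2 μ ν + W2 ν ρ := by
  refine le_of_forall_pos_le_add fun ε hε => ?_
  let m : ℕ → Measure (Ed d) := fun n => if n = 0 then μ else if n = 1 then ν else ρ
  have hm : ∀ n, MemP2 (m n) := fun n => by dsimp only [m]; split_ifs <;> assumption
  obtain ⟨Q, hQ, hQm, hL, hd⟩ := chain_rv m hm (fun n => W2 (m n) (m (n + 1)) + ε / 2)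
    (fun n => by linarith)
  have h3 := W2_map_le (hL 0) (hL 2)
  rw [hQm, hQm] at h3
  have h0 := hd 0
  have h1 := hd 1
  have h4 : (eLpNorm ((fun x : ℕ → Ed d => x 0) - fun x => x 2) 2 Q).toReal ≤
    (eLpNorm ((fun x : ℕ → Ed d => x 0) - fun x => x 1) 2 Q).toReal +
    (eLpNorm ((fun x : ℕ → Ed d => x 1) - fun x => x 2) 2 Q).toReal := by
    rw [← ENNReal.toReal_add ((hL 0).sub (hL 1)).2.ne ((hL 1).sub (hL 2)).2.ne]
    apply ENNReal.toReal_mono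
      (ENNReal.add_ne_top.2 ⟨((hL 0).sub (hL 1)).2.ne, ((hL 1).sub (hL 2)).2.ne⟩)
    have := eLpNorm_add_le ((hL 0).sub (hL 1)).1 ((hL 1).sub (hL 2)).1 (p := 2) (by norm_num)
    simpa using this
  have e0 : m 0 = μ := rfl
  have e1 : m 1 = ν := rfl
  have e2 : m 2 = ρ := rfl
  simp only [zero_add, Nat.reduceAdd, e0, e1, e2] at *
  linarith

/-- The space of probability measures with finite second moment. -/
@[ext]
structure P2 (d : ℕ) : Type where
  val : Measure (Ed d)
  property : MemP2 val

instance (d : ℕ) : PseudoMetricSpace (P2 d) where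
  dist μ ν := W2 μ.1 ν.1
  dist_self μ := W2_self μ.2
  dist_comm μ ν := le_antisymm (W2_le_symm μ.2 ν.2) (W2_le_symm ν.2 μ.2)
  dist_triangle μ ν ρ := W2_triangle μ.2 ν.2 ρ.2

lemma P2.dist_eq {d : ℕ} (μ ν : P2 d) : dist μ ν = W2 μ.1 ν.1 := rfl

instance (d : ℕ) : CompleteSpace (P2 d) := by
  refine Metric.complete_of_convergent_controlled_sequences (fun n => (1 / 2 : ℝ) ^ n)
    (fun n => by positivity) fun u hu => ?_
  obtain ⟨Q, hQ, hQm, hL, hd⟩ := chain_rv (fun n => (u n).1) (fun n => (u n).2)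
    (fun n => (1 / 2 : ℝ) ^ n) (fun n => hu n n (n + 1) le_rfl (by omega))
  let f : ℕ → Lp (Ed d) 2 Q := fun n => (hL n).toLp
  have hf : CauchySeq f := by
    refine cauchySeq_of_le_geometric (1 / 2) 1 (by norm_num) fun n => ?_
    rw [dist_edist, Lp.edist_toLp_toLp, one_mul]
    exact (hd n).le
  obtain ⟨F, hF⟩ := cauchySeq_tendsto_of_complete hf
  have hFL : MemLp F 2 Q := Lp.memLp F
  refine ⟨⟨Q.map F, memP2_map hFL⟩, ?_⟩
  rw [tendsto_iff_dist_tendsto_zero] at hF ⊢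
  refine squeeze_zero (fun _ => dist_nonneg) (fun n => ?_) hF
  rw [P2.dist_eq]
  dsimp only
  rw [← hQm n]
  refine (W2_map_le (hL n) hFL).trans (le_of_eq ?_)
  rw [← Lp.edist_toLp_toLp _ _ (hL n) hFL, Lp.toLp_coeFn, dist_edist]

instance (d : ℕ) : TopologicalSpace.SeparableSpace (P2 d) := by
  let Φ : Lp (Ed d) 2 (volume : Measure unitInterval) → P2 d := fun f =>
    ⟨Measure.map f volume, memP2_map (Lp.memLp f)⟩
  have hΦ : LipschitzWith 1 Φ := by
    refine LipschitzWith.of_dist_le_mul fun f g => ?_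
    rw [P2.dist_eq, NNReal.coe_one, one_mul, Lp.dist_def]
    exact W2_map_le (Lp.memLp f) (Lp.memLp g)
  have hs : Function.Surjective Φ := by
    rintro ⟨μ, hμ⟩
    have := hμ.1
    obtain ⟨f, hf, hfm⟩ := μ.exists_measurable_map_eq
    have hL : MemLp f 2 volume := memLp_of_map hf.aemeasurable (by rw [hfm]; exact hμ)
    refine ⟨hL.toLp, P2.ext ?_⟩
    dsimp only [Φ]
    rw [Measure.map_congr hL.coeFn_toLp, hfm]
  have : Fact ((2 : ℝ≥0∞) ≠ ∞) := ⟨by norm_num⟩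
  exact hs.denseRange.separableSpace hΦ.continuous

open scoped lp in
lemma exists_embedding (S : Type) [MetricSpace S] [TopologicalSpace.SeparableSpace S] :
    ∃ (E : Type) (_ : NormedAddCommGroup E) (_ : NormedSpace ℝ E) (_ : CompleteSpace E)
      (_ : TopologicalSpace.SeparableSpace E) (ψ : S → E), Isometry ψ := by
  let φ := kuratowskiEmbedding S
  have hφ : Isometry φ := kuratowskiEmbedding.isometry S
  let E := (Submodule.span ℝ (Set.range φ)).topologicalClosure
  have hsep : TopologicalSpace.IsSeparable (E : Set ℓ^∞(ℕ, ℝ)) :=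
    (TopologicalSpace.IsSeparable.span (R := ℝ)
      (TopologicalSpace.isSeparable_range hφ.continuous)).closure
  refine ⟨E, inferInstance, inferInstance, inferInstance, hsep.separableSpace,
    fun s => ⟨φ s, subset_closure (Submodule.subset_span ⟨s, rfl⟩)⟩, ?_⟩
  exact fun x y => hφ x y

section general
variable {Ω : Type*} [MeasurableSpace Ω] (P : Measure Ω) {S : Type} [MetricSpace S]
  [MeasurableSpace S]

/-- metric-space valued square integrable maps -/
def MS (o : S) (f : Ω → S) : Prop := Measurable f ∧ Integrable (fun ω => dist (f ω) o ^ 2) P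

def dS (f g : Ω → S) : ℝ := Real.sqrt (∫ ω, dist (f ω) (g ω) ^ 2 ∂P)

theorem general_polish [BorelSpace S] [CompleteSpace S] [TopologicalSpace.SeparableSpace S]
    [MeasurableSpace.CountablyGenerated Ω] [IsProbabilityMeasure P] (o : S) :
    (∀ f : ℕ → Ω → S, (∀ n, MS P o (f n)) →
      (∀ ε : ℝ, 0 < ε → ∃ N : ℕ, ∀ m ≥ N, ∀ n ≥ N, dS P (f m) (f n) < ε) →
      ∃ g : Ω → S, MS P o g ∧ Tendsto (fun n => dS P (f n) g) atTop (𝓝 0)) ∧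
    (∃ D : Set (Ω → S), D.Countable ∧ (∀ η ∈ D, MS P o η) ∧
      ∀ ξ : Ω → S, MS P o ξ → ∀ ε : ℝ, 0 < ε → ∃ η ∈ D, dS P ξ η < ε) := by
  obtain ⟨E, _, _, _, _, ψ, hψ⟩ := exists_embedding S
  have : Fact ((2 : ℝ≥0∞) ≠ ∞) := ⟨by norm_num⟩
  have : SecondCountableTopology S := UniformSpace.secondCountable_of_separable S
  have : SecondCountableTopology E := UniformSpace.secondCountable_of_separable E
  borelize E
  have : Nonempty S := ⟨o⟩
  have hmeas : ∀ f : Ω → S, Measurable f → AEStronglyMeasurable (fun ω => ψ (f ω)) P :=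
    fun f hf => (hψ.continuous.measurable.comp hf).aestronglyMeasurable
  have hmem : ∀ f : Ω → S, MS P o f → MemLp (fun ω => ψ (f ω)) 2 P := by
    intro f hf
    have h1 : MemLp (fun ω => ψ (f ω) - ψ o) 2 P := by
      refine (memLp_two_iff_integrable_sq_norm ((hmeas f hf.1).sub aestronglyMeasurable_const)).2 ?_
      simpa [← dist_eq_norm, hψ.dist_eq] using hf.2
    have h2 := h1.add (memLp_const (ψ o))
    refine h2.ae_eq (ae_of_all _ fun ω => ?_)
    simp
  have hdist : ∀ f g : Ω → S, ∀ (hf : MS P o f) (hg : MS P o g),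
      dist ((hmem f hf).toLp) ((hmem g hg).toLp) = dS P f g := by
    intro f g hf hg
    rw [dist_edist, Lp.edist_toLp_toLp, ← sqrt_integral_sq ((hmem f hf).sub (hmem g hg)), dS]
    congr 2
    ext ω
    simp [← dist_eq_norm, hψ.dist_eq]
  have hcl : MeasurableEmbedding ψ := hψ.isClosedEmbedding.measurableEmbedding
  constructor
  · intro f hf hc
    let F : ℕ → Lp E 2 P := fun n => (hmem (f n) (hf n)).toLp
    have hF : CauchySeq F := by
      rw [Metric.cauchySeq_iff]
      intro ε hε
      obtain ⟨N, hN⟩ := hc ε hε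
      exact ⟨N, fun m hm n hn => by rw [hdist _ _ (hf m) (hf n)]; exact hN m hm n hn⟩
    obtain ⟨G, hG⟩ := cauchySeq_tendsto_of_complete hF
    obtain ⟨ns, -, hns⟩ := (tendstoInMeasure_of_tendsto_Lp hG).exists_seq_tendsto_ae
    have hGm : Measurable G := (Lp.stronglyMeasurable G).measurable
    let g : Ω → S := fun ω => hcl.invFun (G ω)
    have hgm : Measurable g := hcl.measurable_invFun.comp hGm
    have hg : (fun ω => ψ (g ω)) =ᵐ[P] G := by
      have h1 : ∀ᵐ ω ∂P, ∀ n, F n ω = ψ (f n ω) :=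
        ae_all_iff.2 fun n => (hmem (f n) (hf n)).coeFn_toLp
      filter_upwards [hns, h1] with ω hω hω1
      have : G ω ∈ Set.range ψ := by
        refine hψ.isClosedEmbedding.isClosed_range.mem_of_tendsto hω (Eventually.of_forall fun i => ?_)
        rw [hω1]; exact ⟨_, rfl⟩
      obtain ⟨s, hs⟩ := this
      dsimp only [g]
      rw [← hs, hcl.leftInverse_invFun]
    have hgL : MemLp (fun ω => ψ (g ω)) 2 P := (Lp.memLp G).ae_eq hg.symm
    have hgM : MS P o g := by
      refine ⟨hgm, ?_⟩
      have := (hgL.sub (memLp_const (ψ o))).norm.integrable_sq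
      simpa [← dist_eq_norm, hψ.dist_eq] using this
    refine ⟨g, hgM, ?_⟩
    have hGg : (hmem g hgM).toLp = G := Lp.ext ((hmem g hgM).coeFn_toLp.trans hg)
    rw [tendsto_iff_dist_tendsto_zero] at hG
    refine hG.congr fun n => ?_
    rw [← hGg, hdist _ _ (hf n) hgM]
  · let T := {f : Ω → S // MS P o f}
    let Φ : T → Lp E 2 P := fun f => (hmem f.1 f.2).toLp
    have hsep : TopologicalSpace.IsSeparable (Set.range Φ) := .of_separableSpace _
    obtain ⟨C, hC1, hC2, hC3⟩ := hsep.exists_countable_dense_subset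
    obtain ⟨D, hD, hDC⟩ : ∃ D : Set T, D.Countable ∧ Φ '' D = C := by
      obtain ⟨D, -, hb⟩ := Set.SurjOn.exists_bijOn_subset (f := Φ) (s := Set.univ) (t := C)
        (by rw [Set.SurjOn, Set.image_univ]; exact hC1)
      refine ⟨D, ?_, hb.image_eq⟩
      exact Set.countable_of_injective_of_countable_image hb.injOn (by rw [hb.image_eq]; exact hC2)
    refine ⟨Subtype.val '' D, hD.image _, ?_, ?_⟩
    · rintro _ ⟨η, -, rfl⟩; exact η.2
    · intro ξ hξ ε hε
      have h1 : Φ ⟨ξ, hξ⟩ ∈ closure C := hC3 ⟨_, rfl⟩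
      obtain ⟨c, hc, hcd⟩ := Metric.mem_closure_iff.1 h1 ε hε
      rw [← hDC] at hc
      obtain ⟨η, hη, rfl⟩ := hc
      refine ⟨η.1, ⟨η, hη, rfl⟩, ?_⟩
      rw [← hdist ξ η.1 hξ η.2]
      exact hcd

lemma measurable_of_dist [BorelSpace S] [TopologicalSpace.SeparableSpace S] (f : Ω → S)
    (h : ∀ s, Measurable fun ω => dist (f ω) s) : Measurable f := by
  have : SecondCountableTopology S := UniformSpace.secondCountable_of_separable S
  have hb : TopologicalSpace.IsTopologicalBasis
      {s : Set S | ∃ x r, s = Metric.ball x r} := by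
    refine TopologicalSpace.isTopologicalBasis_of_isOpen_of_nhds ?_ ?_
    · rintro _ ⟨x, r, rfl⟩; exact Metric.isOpen_ball
    · intro a u ha hu
      obtain ⟨r, hr, hru⟩ := Metric.isOpen_iff.1 hu a ha
      exact ⟨_, ⟨a, r, rfl⟩, Metric.mem_ball_self hr, hru⟩
  rw [‹BorelSpace S›.measurable_eq, hb.borel_eq_generateFrom]
  refine measurable_generateFrom ?_
  rintro _ ⟨x, r, rfl⟩
  exact measurableSet_lt (h x) measurable_const

end general

lemma W2_eq_zero {d : ℕ} {μ ν : Measure (Ed d)} (hμ : ¬ MemP2 μ) (hν : MemP2 ν) : W2 μ ν = 0 := by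
  have h : transportCosts μ ν ⊆ {0} := by
    rintro c ⟨γ, hγ, rfl⟩
    have := hγ.1
    refine integral_undef fun hi => hμ ?_
    have h2 : MemLp (fun p => p.2 : Ed d × Ed d → Ed d) 2 γ :=
      memLp_of_map (by fun_prop) (by rw [show γ.map _ = ν from hγ.2.2]; exact hν)
    have h3 : MemLp (fun p => p.1 - p.2 : Ed d × Ed d → Ed d) 2 γ :=
      (memLp_two_iff_integrable_sq_norm (by fun_prop)).2 hi
    have h4 : MemLp (fun p => p.1 : Ed d × Ed d → Ed d) 2 γ :=
      (h3.add h2).ae_eq (ae_of_all _ fun ω => by simp)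
    have h5 := memP2_map h4
    rwa [show γ.map _ = μ from hγ.2.1] at h5
  rw [W2]
  rcases Set.subset_singleton_iff_eq.1 h with h | h <;> simp [h]

lemma memP2_dirac (d : ℕ) : MemP2 (Measure.dirac (0 : Ed d)) :=
  ⟨inferInstance, integrable_dirac (by simp)⟩

lemma W2_dirac {d : ℕ} {ν : Measure (Ed d)} (hν : MemP2 ν) :
    W2 ν (Measure.dirac 0) ^ 2 = ∫ x, ‖x‖ ^ 2 ∂ν := by
  have := hν.1
  have h : transportCosts ν (Measure.dirac 0) ⊆ {∫ x, ‖x‖ ^ 2 ∂ν} := by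
    rintro c ⟨γ, hγ, rfl⟩
    have h0 : ∀ᵐ p ∂γ, p.2 = 0 := by
      have : ∀ᵐ y ∂(γ.map Prod.snd), y = 0 := by
        rw [hγ.2.2]; simp [ae_dirac_eq]
      exact ae_of_ae_map (by fun_prop) this
    rw [Set.mem_singleton_iff, ← hγ.2.1, integral_map (by fun_prop) (by fun_prop)]
    refine integral_congr_ae ?_
    filter_upwards [h0] with p hp
    simp [hp]
  have hne : (transportCosts ν (Measure.dirac 0)).Nonempty :=
    ⟨_, ν.prod (Measure.dirac 0), ⟨inferInstance, by simp, by simp⟩, rfl⟩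
  rw [W2, hne.subset_singleton_iff.1 h, csInf_singleton, Real.sq_sqrt (by positivity)]

abbrev S2 (d : ℕ) : Type := SeparationQuotient (P2 d)

def toS {d : ℕ} {Ω : Type*} (ξ : Ω → Measure (Ed d)) (h : ∀ ω, MemP2 (ξ ω)) : Ω → S2 d :=
  fun ω => SeparationQuotient.mk ⟨ξ ω, h ω⟩

def fromS {d : ℕ} {Ω : Type*} (f : Ω → S2 d) : Ω → Measure (Ed d) :=
  fun ω => (Quotient.out (f ω)).1

lemma fromS_mem {d : ℕ} {Ω : Type*} (f : Ω → S2 d) (ω : Ω) : MemP2 (fromS f ω) :=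
  (Quotient.out (f ω)).2

lemma toS_fromS {d : ℕ} {Ω : Type*} (f : Ω → S2 d) : toS (fromS f) (fromS_mem f) = f := by
  ext ω
  exact Quotient.out_eq (f ω)

instance (d : ℕ) : MeasurableSpace (S2 d) := borel _
instance (d : ℕ) : BorelSpace (S2 d) := ⟨rfl⟩

instance (d : ℕ) : TopologicalSpace.SeparableSpace (S2 d) :=
  (SeparationQuotient.surjective_mk (X := P2 d)).denseRange.separableSpace
    SeparationQuotient.continuous_mk

def oS (d : ℕ) : S2 d := SeparationQuotient.mk ⟨Measure.dirac 0, memP2_dirac d⟩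

lemma memL2W_iff {d : ℕ} {Ω : Type*} [MeasurableSpace Ω] (P : Measure Ω)
    (ξ : Ω → Measure (Ed d)) (h : ∀ ω, MemP2 (ξ ω)) :
    MemL2W P ξ ↔ MS P (oS d) (toS ξ h) := by
  have he : (fun ω => dist (toS ξ h ω) (oS d) ^ 2) = fun ω => ∫ x, ‖x‖ ^ 2 ∂(ξ ω) := by
    ext ω
    rw [← W2_dirac (h ω)]; rfl
  constructor
  · intro H
    refine ⟨measurable_of_dist _ fun s => ?_, ?_⟩
    · obtain ⟨ν, rfl⟩ := SeparationQuotient.surjective_mk s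
      refine measurable_of_Iio fun r => ?_
      have := @H.meas {ν' | W2 ν.1 ν' < r} (MeasurableSpace.measurableSet_generateFrom ⟨ν.1, r, rfl⟩)
      convert this using 1
      ext ω
      simp only [Set.mem_preimage, Set.mem_Iio, Set.mem_ofPred_eq]
      rw [dist_comm]; rfl
    · rw [he]; exact H.energy
  · intro H
    refine ⟨fun ω => (h ω).1, fun ω => (h ω).2, ?_, ?_⟩
    · refine @measurable_generateFrom _ _ _ _ _ ?_
      rintro _ ⟨μ, r, rfl⟩
      by_cases hμ : MemP2 μ
      · have := measurableSet_lt (H.1.dist (measurable_const (a := SeparationQuotient.mk (⟨μ, hμ⟩ : P2 d))))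
          (measurable_const (a := r))
        convert this using 1
        ext ω
        simp only [Set.mem_preimage, Set.mem_ofPred_eq]
        rw [dist_comm]; rfl
      · have : ξ ⁻¹' {ν | W2 μ ν < r} = {_ω | 0 < r} := by
          ext ω
          simp only [Set.mem_preimage, Set.mem_ofPred_eq, W2_eq_zero hμ (h ω)]
        rw [this]
        exact MeasurableSet.const _
    · rw [← he]; exact H.2

lemma MemL2W.memP2 {d : ℕ} {Ω : Type*} [MeasurableSpace Ω] {P : Measure Ω}
    {ξ : Ω → Measure (Ed d)} (h : MemL2W P ξ) (ω : Ω) : MemP2 (ξ ω) := ⟨h.prob ω, h.mom ω⟩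

lemma dL2_eq {d : ℕ} {Ω : Type*} [MeasurableSpace Ω] (P : Measure Ω)
    (ξ η : Ω → Measure (Ed d)) (h : ∀ ω, MemP2 (ξ ω)) (h' : ∀ ω, MemP2 (η ω)) :
    dL2 P ξ η = dS P (toS ξ h) (toS η h') := rfl

/-- If the σ-algebra `𝒜` on `Ω` is countably generated, then
`(L²_W(ℝ^d), d)` (with ℙ-a.s. equal elements identified) is a Polish space: it is complete
(every `d`-Cauchy sequence in `L²_W(ℝ^d)` converges in `d` to an element of `L²_W(ℝ^d)`)
and separable (there is a countable subset of `L²_W(ℝ^d)` that is `d`-dense). -/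
theorem L2W_polish (d : ℕ) {Ω : Type*} [MeasurableSpace Ω]
    [MeasurableSpace.CountablyGenerated Ω]
    (P : Measure Ω) [IsProbabilityMeasure P] :
    (∀ ξ : ℕ → Ω → Measure (Ed d), (∀ n, MemL2W P (ξ n)) →
      (∀ ε : ℝ, 0 < ε → ∃ N : ℕ, ∀ m ≥ N, ∀ n ≥ N, dL2 P (ξ m) (ξ n) < ε) →
      ∃ ξ' : Ω → Measure (Ed d), MemL2W P ξ' ∧
        Tendsto (fun n => dL2 P (ξ n) ξ') atTop (𝓝 0)) ∧
    (∃ D : Set (Ω → Measure (Ed d)), D.Countable ∧ (∀ η ∈ D, MemL2W P η) ∧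
      ∀ ξ : Ω → Measure (Ed d), MemL2W P ξ → ∀ ε : ℝ, 0 < ε →
        ∃ η ∈ D, dL2 P ξ η < ε) := by
  obtain ⟨h1, D, hD, hDM, hDd⟩ := general_polish P (oS d) (Ω := Ω)
  constructor
  · intro ξ hξ hc
    obtain ⟨g, hg, hgt⟩ := h1 (fun n => toS (ξ n) (hξ n).memP2)
      (fun n => (memL2W_iff P _ _).1 (hξ n)) hc
    refine ⟨fromS g, (memL2W_iff P _ (fromS_mem g)).2 (by rw [toS_fromS]; exact hg), ?_⟩
    refine hgt.congr fun n => ?_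
    rw [dL2_eq P (ξ n) (fromS g) (hξ n).memP2 (fromS_mem g), toS_fromS]
  · refine ⟨fromS '' D, hD.image _, ?_, ?_⟩
    · rintro _ ⟨g, hg, rfl⟩
      exact (memL2W_iff P _ (fromS_mem g)).2 (by rw [toS_fromS]; exact hDM g hg)
    · intro ξ hξ ε hε
      obtain ⟨g, hg, hlt⟩ := hDd _ ((memL2W_iff P _ hξ.memP2).1 hξ) ε hε
      refine ⟨fromS g, ⟨g, hg, rfl⟩, ?_⟩
      rw [dL2_eq P ξ (fromS g) hξ.memP2 (fromS_mem g), toS_fromS]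
      exact hlt
end
end

section
/- Fix β > 0 and for a probability measure μ on the unit sphere 𝕊^{d−1} ⊂ ℝ^d define the un-normalised self-attention vector field v_μ(x) = P⊥_x( ∫ e^{β⟨x,y⟩} y dμ(y) ), where P⊥_x y = y − ⟨x,y⟩x is the orthogonal projection onto the tangent space of 𝕊^{d−1} at x. Then for all probability measures μ, ν on 𝕊^{d−1} and all x, x' ∈ 𝕊^{d−1}: (i) ‖v_μ(x) − v_ν(x)‖ ≤ (β+1) e^{β} W₂(μ, ν); (ii) ‖v_μ(x) − v_μ(x')‖ ≤ (β+2) e^{β} ‖x − x'‖. -/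
open MeasureTheory Filter Topology ProbabilityTheory
open scoped ENNReal NNReal RealInnerProductSpace BigOperators

noncomputable section

/-- The orthogonal projection onto the tangent space of the unit sphere at `x`:
`P⊥_x y = y − ⟨x,y⟩x`. -/
def sphereProj {d : ℕ} (x y : Ed d) : Ed d := y - ⟪x, y⟫ • x

/-- The un-normalised self-attention vector field
`v_μ(x) = P⊥_x(∫ e^{β⟨x,y⟩} y dμ(y))`. -/
def usaField {d : ℕ} (β : ℝ) (μ : Measure (Ed d)) (x : Ed d) : Ed d :=
  sphereProj x (∫ y, Real.exp (β * ⟪x, y⟫) • y ∂μ)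

lemma usa_proj_le {d : ℕ} (x y : Ed d) (hx : ‖x‖ = 1) : ‖sphereProj x y‖ ≤ ‖y‖ := by
  have h : ‖sphereProj x y‖ ^ 2 = ‖y‖ ^ 2 - ⟪x, y⟫ ^ 2 := by
    unfold sphereProj
    rw [norm_sub_sq_real, inner_smul_right, norm_smul, real_inner_comm x y, hx, Real.norm_eq_abs,
      mul_one, sq_abs]
    ring
  exact (sq_le_sq₀ (norm_nonneg _) (norm_nonneg _)).1 (by nlinarith [sq_nonneg ⟪x, y⟫])

lemma usa_exp_lip_aux (β : ℝ) (hβ : 0 < β) (s t : ℝ) (hs : s ≤ 1) :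
    Real.exp (β * s) - Real.exp (β * t) ≤ β * Real.exp β * |s - t| := by
  have h1 : Real.exp (β * s) - Real.exp (β * t) ≤ Real.exp (β * s) * (β * (s - t)) := by
    have h := Real.add_one_le_exp (β * t - β * s)
    have h2 : Real.exp (β * t) = Real.exp (β * s) * Real.exp (β * t - β * s) := by
      rw [← Real.exp_add]; congr 1; ring
    rw [h2]
    nlinarith [Real.exp_pos (β * s)]
  have h3 : Real.exp (β * s) ≤ Real.exp β := Real.exp_le_exp.2 (by nlinarith)
  calc _ ≤ Real.exp (β * s) * (β * (s - t)) := h1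
    _ ≤ Real.exp (β * s) * (β * |s - t|) := by gcongr; exact le_abs_self _
    _ ≤ Real.exp β * (β * |s - t|) := by gcongr
    _ = _ := by ring

lemma usa_exp_lip (β : ℝ) (hβ : 0 < β) (s t : ℝ) (hs : s ≤ 1) (ht : t ≤ 1) :
    |Real.exp (β * s) - Real.exp (β * t)| ≤ β * Real.exp β * |s - t| := by
  rw [abs_sub_le_iff]
  refine ⟨usa_exp_lip_aux β hβ s t hs, ?_⟩
  rw [abs_sub_comm]
  exact usa_exp_lip_aux β hβ t s ht

lemma usa_inner_le {d : ℕ} (x y : Ed d) (hx : ‖x‖ = 1) (hy : ‖y‖ = 1) : ⟪x, y⟫ ≤ 1 := by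
  have := real_inner_le_norm x y
  rwa [hx, hy, mul_one] at this

lemma usa_kernel_norm {d : ℕ} (β : ℝ) (hβ : 0 < β) (x y : Ed d) (hx : ‖x‖ = 1) (hy : ‖y‖ = 1) :
    ‖Real.exp (β * ⟪x, y⟫) • y‖ ≤ Real.exp β := by
  rw [norm_smul, hy, mul_one, Real.norm_eq_abs, Real.abs_exp]
  exact Real.exp_le_exp.2 (by nlinarith [usa_inner_le x y hx hy])

lemma usa_kernel_meas {d : ℕ} (β : ℝ) (x : Ed d) :
    Continuous (fun y : Ed d => Real.exp (β * ⟪x, y⟫) • y) := by fun_prop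

lemma usa_kernel_int {d : ℕ} (β : ℝ) (hβ : 0 < β) (μ : Measure (Ed d)) [IsProbabilityMeasure μ]
    (hμs : ∀ᵐ y ∂μ, ‖y‖ = 1) (x : Ed d) (hx : ‖x‖ = 1) :
    Integrable (fun y : Ed d => Real.exp (β * ⟪x, y⟫) • y) μ := by
  refine Integrable.of_bound (usa_kernel_meas β x).aestronglyMeasurable (Real.exp β) ?_
  filter_upwards [hμs] with y hy
  exact usa_kernel_norm β hβ x y hx hy

lemma usa_kernel_lip_y {d : ℕ} (β : ℝ) (hβ : 0 < β) (x y z : Ed d) (hx : ‖x‖ = 1)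
    (hy : ‖y‖ = 1) (hz : ‖z‖ = 1) :
    ‖Real.exp (β * ⟪x, y⟫) • y - Real.exp (β * ⟪x, z⟫) • z‖
      ≤ (β + 1) * Real.exp β * ‖y - z‖ := by
  have e : Real.exp (β * ⟪x, y⟫) • y - Real.exp (β * ⟪x, z⟫) • z
      = (Real.exp (β * ⟪x, y⟫) - Real.exp (β * ⟪x, z⟫)) • y
        + Real.exp (β * ⟪x, z⟫) • (y - z) := by
    rw [sub_smul, smul_sub]; abel
  have h1 := usa_exp_lip β hβ ⟪x, y⟫ ⟪x, z⟫ (usa_inner_le x y hx hy) (usa_inner_le x z hx hz)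
  have h2 : |⟪x, y⟫ - ⟪x, z⟫| ≤ ‖y - z‖ := by
    rw [← inner_sub_right]
    simpa [hx] using abs_real_inner_le_norm x (y - z)
  have h3 : Real.exp (β * ⟪x, z⟫) ≤ Real.exp β :=
    Real.exp_le_exp.2 (by nlinarith [usa_inner_le x z hx hz])
  rw [e]
  refine (norm_add_le _ _).trans ?_
  rw [norm_smul, norm_smul, hy, mul_one, Real.norm_eq_abs, Real.norm_eq_abs, Real.abs_exp]
  calc _ ≤ β * Real.exp β * ‖y - z‖ + Real.exp β * ‖y - z‖ := by
        gcongr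
        exact h1.trans (by gcongr)
    _ = _ := by ring

lemma usa_kernel_lip_x {d : ℕ} (β : ℝ) (hβ : 0 < β) (x x' y : Ed d) (hx : ‖x‖ = 1)
    (hx' : ‖x'‖ = 1) (hy : ‖y‖ = 1) :
    ‖Real.exp (β * ⟪x, y⟫) • y - Real.exp (β * ⟪x', y⟫) • y‖ ≤ β * Real.exp β * ‖x - x'‖ := by
  have h1 := usa_exp_lip β hβ ⟪x, y⟫ ⟪x', y⟫ (usa_inner_le x y hx hy) (usa_inner_le x' y hx' hy)
  have h2 : |⟪x, y⟫ - ⟪x', y⟫| ≤ ‖x - x'‖ := by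
    rw [← inner_sub_left]
    simpa [hy] using abs_real_inner_le_norm (x - x') y
  rw [← sub_smul, norm_smul, hy, mul_one, Real.norm_eq_abs]
  exact h1.trans (by gcongr)

lemma usa_proj_sub {d : ℕ} (x a b : Ed d) :
    sphereProj x a - sphereProj x b = sphereProj x (a - b) := by
  unfold sphereProj
  rw [inner_sub_right, sub_smul]; abel

lemma usa_proj_lip {d : ℕ} (x x' a : Ed d) (hx : ‖x‖ = 1) (hx' : ‖x'‖ = 1) :
    ‖sphereProj x a - sphereProj x' a‖ ≤ 2 * ‖a‖ * ‖x - x'‖ := by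
  have e : sphereProj x a - sphereProj x' a
      = ⟪x' - x, a⟫ • x' + ⟪x, a⟫ • (x' - x) := by
    unfold sphereProj
    rw [inner_sub_left, sub_smul, smul_sub]; abel
  rw [e]
  refine (norm_add_le _ _).trans ?_
  rw [norm_smul, norm_smul, hx', mul_one, Real.norm_eq_abs, Real.norm_eq_abs, norm_sub_rev x x']
  have h1 := abs_real_inner_le_norm (x' - x) a
  have h2 := abs_real_inner_le_norm x a
  rw [hx, one_mul] at h2
  nlinarith [norm_nonneg (x' - x)]

lemma usa_cost_bound {d : ℕ} (β : ℝ) (hβ : 0 < β)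
    (μ ν : Measure (Ed d)) [IsProbabilityMeasure μ] [IsProbabilityMeasure ν]
    (hμs : ∀ᵐ y ∂μ, ‖y‖ = 1) (hνs : ∀ᵐ y ∂ν, ‖y‖ = 1) (x : Ed d) (hx : ‖x‖ = 1)
    (γ : Measure (Ed d × Ed d)) (hγ : IsCoupling γ μ ν) :
    ‖(∫ y, Real.exp (β * ⟪x, y⟫) • y ∂μ) - ∫ y, Real.exp (β * ⟪x, y⟫) • y ∂ν‖ ^ 2
      ≤ ((β + 1) * Real.exp β) ^ 2 * ∫ p, ‖p.1 - p.2‖ ^ 2 ∂γ := by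
  obtain ⟨hp, h1, h2⟩ := hγ
  have q1 : ∀ᵐ p ∂γ, ‖p.1‖ = 1 := by
    rw [← h1] at hμs; exact ae_of_ae_map measurable_fst.aemeasurable hμs
  have q2 : ∀ᵐ p ∂γ, ‖p.2‖ = 1 := by
    rw [← h2] at hνs; exact ae_of_ae_map measurable_snd.aemeasurable hνs
  have i1 := usa_kernel_int β hβ μ hμs x hx
  have i2 := usa_kernel_int β hβ ν hνs x hx
  have e1 : ∫ y, Real.exp (β * ⟪x, y⟫) • y ∂μ = ∫ p, Real.exp (β * ⟪x, p.1⟫) • p.1 ∂γ := by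
    rw [← h1]
    exact integral_map measurable_fst.aemeasurable (usa_kernel_meas β x).aestronglyMeasurable
  have e2 : ∫ y, Real.exp (β * ⟪x, y⟫) • y ∂ν = ∫ p, Real.exp (β * ⟪x, p.2⟫) • p.2 ∂γ := by
    rw [← h2]
    exact integral_map measurable_snd.aemeasurable (usa_kernel_meas β x).aestronglyMeasurable
  have j1 : Integrable (fun p : Ed d × Ed d => Real.exp (β * ⟪x, p.1⟫) • p.1) γ := by
    rw [← h1] at i1; exact i1.comp_measurable measurable_fst
  have j2 : Integrable (fun p : Ed d × Ed d => Real.exp (β * ⟪x, p.2⟫) • p.2) γ := by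
    rw [← h2] at i2; exact i2.comp_measurable measurable_snd
  have hm : MemLp (fun p : Ed d × Ed d => ‖p.1 - p.2‖) 2 γ := by
    refine MemLp.of_bound (by fun_prop) 2 ?_
    filter_upwards [q1, q2] with p hp1 hp2
    rw [norm_norm]
    have := norm_sub_le p.1 p.2
    rw [hp1, hp2] at this
    linarith
  have k1 : Integrable (fun p : Ed d × Ed d => ‖p.1 - p.2‖) γ := hm.integrable (by norm_num)
  have hb : ‖(∫ y, Real.exp (β * ⟪x, y⟫) • y ∂μ) - ∫ y, Real.exp (β * ⟪x, y⟫) • y ∂ν‖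
      ≤ (β + 1) * Real.exp β * ∫ p, ‖p.1 - p.2‖ ∂γ := by
    rw [e1, e2, ← integral_sub j1 j2, ← integral_const_mul]
    refine norm_integral_le_of_norm_le (k1.const_mul _) ?_
    filter_upwards [q1, q2] with p hp1 hp2
    exact usa_kernel_lip_y β hβ x p.1 p.2 hx hp1 hp2
  have hv : (∫ p, ‖p.1 - p.2‖ ∂γ) ^ 2 ≤ ∫ p, ‖p.1 - p.2‖ ^ 2 ∂γ := by
    have h := variance_eq_sub hm
    have h' := variance_nonneg (fun p : Ed d × Ed d => ‖p.1 - p.2‖) γ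
    rw [h] at h'
    simpa using h'
  calc _ ≤ ((β + 1) * Real.exp β * ∫ p, ‖p.1 - p.2‖ ∂γ) ^ 2 := by gcongr
    _ = ((β + 1) * Real.exp β) ^ 2 * (∫ p, ‖p.1 - p.2‖ ∂γ) ^ 2 := by ring
    _ ≤ _ := by gcongr

/-- For probability measures `μ, ν` supported on the unit sphere
`𝕊^{d−1}` and points `x, x'` on the sphere, the un-normalised self-attention vector field
is `(β+1)e^β`-Lipschitz in the measure (w.r.t. `W₂`) and `(β+2)e^β`-Lipschitz in the
space variable. -/
theorem usaField_lipschitz {d : ℕ} (β : ℝ) (hβ : 0 < β)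
    (μ ν : Measure (Ed d)) (hμ : IsProbabilityMeasure μ) (hν : IsProbabilityMeasure ν)
    (hμs : μ {y | ‖y‖ = 1}ᶜ = 0) (hνs : ν {y | ‖y‖ = 1}ᶜ = 0)
    (x x' : Ed d) (hx : ‖x‖ = 1) (hx' : ‖x'‖ = 1) :
    ‖usaField β μ x - usaField β ν x‖ ≤ (β + 1) * Real.exp β * W2 μ ν ∧
    ‖usaField β μ x - usaField β μ x'‖ ≤ (β + 2) * Real.exp β * ‖x - x'‖ := by
  have aμ : ∀ᵐ y ∂μ, ‖y‖ = 1 := hμs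
  have aν : ∀ᵐ y ∂ν, ‖y‖ = 1 := hνs
  have hK : 0 < (β + 1) * Real.exp β := by positivity
  constructor
  · unfold usaField
    rw [usa_proj_sub]
    refine (usa_proj_le _ _ hx).trans ?_
    rw [← div_le_iff₀' hK]
    unfold W2
    refine Real.le_sqrt_of_sq_le (le_csInf ?_ ?_)
    · exact ⟨_, μ.prod ν, ⟨inferInstance, Measure.fst_prod,
        Measure.snd_prod⟩, rfl⟩
    · rintro c ⟨γ, hγ, rfl⟩
      rw [div_pow, div_le_iff₀' (by positivity)]
      exact usa_cost_bound β hβ μ ν aμ aν x hx γ hγ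
  · have i1 := usa_kernel_int β hβ μ aμ x hx
    have i2 := usa_kernel_int β hβ μ aμ x' hx'
    have hA : ‖(∫ y, Real.exp (β * ⟪x, y⟫) • y ∂μ) - ∫ y, Real.exp (β * ⟪x', y⟫) • y ∂μ‖
        ≤ β * Real.exp β * ‖x - x'‖ := by
      rw [← integral_sub i1 i2]
      have := norm_integral_le_of_norm_le_const (μ := μ)
        (f := fun y : Ed d => Real.exp (β * ⟪x, y⟫) • y - Real.exp (β * ⟪x', y⟫) • y)
        (C := β * Real.exp β * ‖x - x'‖) (by
          filter_upwards [aμ] with y hy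
          exact usa_kernel_lip_x β hβ x x' y hx hx' hy)
      simpa using this
    have hB : ‖∫ y, Real.exp (β * ⟪x', y⟫) • y ∂μ‖ ≤ Real.exp β := by
      have := norm_integral_le_of_norm_le_const (μ := μ)
        (f := fun y : Ed d => Real.exp (β * ⟪x', y⟫) • y) (C := Real.exp β) (by
          filter_upwards [aμ] with y hy
          exact usa_kernel_norm β hβ x' y hx' hy)
      simpa using this
    unfold usaField
    set A := ∫ y, Real.exp (β * ⟪x, y⟫) • y ∂μ
    set B := ∫ y, Real.exp (β * ⟪x', y⟫) • y ∂μ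
    calc ‖sphereProj x A - sphereProj x' B‖
        = ‖sphereProj x (A - B) + (sphereProj x B - sphereProj x' B)‖ := by
          rw [← usa_proj_sub]; congr 1; abel
      _ ≤ ‖sphereProj x (A - B)‖ + ‖sphereProj x B - sphereProj x' B‖ := norm_add_le _ _
      _ ≤ β * Real.exp β * ‖x - x'‖ + 2 * Real.exp β * ‖x - x'‖ := by
          refine add_le_add ((usa_proj_le _ _ hx).trans hA) ((usa_proj_lip _ _ _ hx hx').trans ?_)
          gcongr
      _ = _ := by ring
end
end
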